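/- Fix integers m ≥ 1 and n ≥ 2 and set N = m·n + 2. The number of (m+2)-angulations of the N-gon is the Fuss–Catalan number (1/(m·n + 1))·binom((m+1)·n, n); that is, (m·n + 1) times the number of (m+2)-angulations equals the binomial coefficient binom((m+1)·n, n). -/

import Mathlib

/-- `d` is an `m`-diagonal of the `(m*n+2)`-gon, whose vertices are identified with
`ZMod (m*n+2)` in cyclic order: `d = {a, b}` where `a, b` are distinct non-adjacent
vertices with `b - a = m*i + 1` for some `1 ≤ i ≤ n - 1`. -/
def IsMDiag (m n : ℕ) (d : Finset (ZMod (m * n + 2))) : Prop :=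
  ∃ a b : ZMod (m * n + 2), d = {a, b} ∧ a ≠ b ∧ b - a ≠ 1 ∧ a - b ≠ 1 ∧
    ∃ i : ℕ, 1 ≤ i ∧ i ≤ n - 1 ∧ b - a = ((m * i + 1 : ℕ) : ZMod (m * n + 2))

/-- `x` lies strictly inside the arc of the cycle `ZMod N` going (clockwise) from `a` to `b`. -/
def InOpenArc {N : ℕ} (a b x : ZMod N) : Prop :=
  ∃ k : ℕ, 0 < k ∧ k < (b - a).val ∧ x = a + (k : ZMod N)

/-- Two diagonals `D = {a, b}` and `E = {c, d}` cross: one of `c, d` lies strictly inside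
one of the two arcs determined by `a` and `b`, and the other lies strictly inside the
other arc. -/
def Crosses {N : ℕ} (D E : Finset (ZMod N)) : Prop :=
  ∃ a b c d : ZMod N, D = {a, b} ∧ E = {c, d} ∧ InOpenArc a b c ∧ InOpenArc b a d

/-- `S` is a set of pairwise noncrossing `m`-diagonals of the `(m*n+2)`-gon. -/
def NonCrossingMDiags (m n : ℕ) (S : Finset (Finset (ZMod (m * n + 2)))) : Prop :=
  (∀ D ∈ S, IsMDiag m n D) ∧ ∀ D ∈ S, ∀ E ∈ S, D ≠ E → ¬ Crosses D E

/-- An `(m+2)`-angulation: an inclusion-maximal set of pairwise noncrossing `m`-diagonals. -/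
def IsAngulation (m n : ℕ) (S : Finset (Finset (ZMod (m * n + 2)))) : Prop :=
  NonCrossingMDiags m n S ∧ ∀ S', NonCrossingMDiags m n S' → S ⊆ S' → S' = S


/-- Rothe numbers. -/
def fcA (p : ℕ) : ℕ → ℕ → ℕ
  | 0, _ => 1
  | n+1, x => ∑ j ∈ Finset.range x, fcA p n (j + p)

lemma fcA_succ_zero (p n : ℕ) : fcA p (n+1) 0 = 0 := by simp [fcA]

lemma fcA_succ_succ (p n x : ℕ) : fcA p (n+1) (x+1) = fcA p (n+1) x + fcA p n (x + p) := by
  simp [fcA, Finset.sum_range_succ]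

lemma fcA_conv (p : ℕ) : ∀ n x y, ∑ i ∈ Finset.range (n+1), fcA p i x * fcA p (n-i) y = fcA p n (x+y) := by
  intro n
  induction n with
  | zero => intro x y; simp [fcA]
  | succ n ihn =>
    intro x y
    induction x with
    | zero =>
      rw [Finset.sum_range_succ']
      simp [fcA]
    | succ x ihx =>
      rw [Finset.sum_range_succ'] at ihx ⊢
      have h1 : ∀ i ∈ Finset.range (n+1), fcA p (i+1) (x+1) * fcA p (n+1-(i+1)) y =
          fcA p (i+1) x * fcA p (n+1-(i+1)) y + fcA p i (x+p) * fcA p (n-i) y := by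
        intro i _
        rw [fcA_succ_succ, add_mul]
        simp
      rw [Finset.sum_congr rfl h1, Finset.sum_add_distrib, ihn]
      have e : x + 1 + y = (x+y)+1 := by ring
      rw [e, fcA_succ_succ, ← ihx]
      have e2 : x + p + y = x + y + p := by ring
      rw [e2]
      simp [fcA]
      ring

lemma fcA_closed (m : ℕ) : ∀ n x, (x + n*(m+1)) * fcA (m+1) n x = x * Nat.choose (x + n*(m+1)) n := by
  intro n
  induction n with
  | zero => intro x; simp [fcA]
  | succ n ihn =>
    intro x
    induction x with
    | zero => simp [fcA_succ_zero]
    | succ x ihx =>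
      rw [fcA_succ_succ]
      have h2 := ihn (x+(m+1))
      set M := x + (n+1)*(m+1) with hM
      have e1 : x + (m+1) + n*(m+1) = M := by rw [hM]; ring
      have e2 : x + 1 + (n+1)*(m+1) = M + 1 := by rw [hM]; ring
      rw [e1] at h2
      rw [e2]
      have hMpos : 0 < M := by rw [hM]; positivity
      have p1 := Nat.choose_succ_succ M n
      have hle : n ≤ M := by rw [hM]; nlinarith
      -- C(M,n+1)*(n+1) = C(M,n)*(M-n)
      have p2 := Nat.choose_succ_right_eq M n
      obtain ⟨r, hr⟩ := Nat.exists_eq_add_of_le hle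
      have hr' : M - n = r := by omega
      rw [hr'] at p2
      apply Nat.eq_of_mul_eq_mul_left hMpos
      apply Nat.eq_of_mul_eq_mul_left (Nat.succ_pos n)
      rw [p1]
      have q : M * (fcA (m+1) (n+1) x + fcA (m+1) n (x+(m+1))) = x * M.choose (n+1) + (x+(m+1)) * M.choose n := by
        rw [mul_add, ihx, h2]
      calc (n+1) * (M * ((M+1) * (fcA (m+1) (n+1) x + fcA (m+1) n (x+(m+1)))))
          = (n+1) * (M+1) * (M * (fcA (m+1) (n+1) x + fcA (m+1) n (x+(m+1)))) := by ring
        _ = (M+1) * (x * (M.choose (n+1) * (n+1)) + (n+1) * (x+(m+1)) * M.choose n) := by rw [q]; ring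
        _ = (M+1) * M * (x+1) * M.choose n := by
            rw [p2]
            have : x * r + (n+1)*(x+(m+1)) = M * (x + 1) := by
              have : (x:ℤ) * r + (n+1)*(x+(m+1)) = M * (x + 1) := by
                have a1 : (M:ℤ) = n + r := by exact_mod_cast hr
                have a2 : (M:ℤ) = x + (n+1)*(m+1) := by exact_mod_cast hM
                linear_combination (-(x:ℤ)) * a1 - a2 
              exact_mod_cast this
            calc _ = (M+1) * (x * r + (n+1)*(x+(m+1))) * M.choose n := by ring
              _ = _ := by rw [this]; ring
        _ = M * (x+1) * (M.choose n * (n+1) + M.choose n * r) := by rw [hr]; ring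
        _ = _ := by rw [← p2]; simp only [Nat.succ_eq_add_one]; ring

/-- Fuss–Catalan -/
def fc (m n : ℕ) : ℕ := fcA (m+1) n 1

lemma fc_zero (m : ℕ) : fc m 0 = 1 := by simp [fc, fcA]
lemma fc_one (m : ℕ) : fc m 1 = 1 := by simp [fc, fcA]

lemma fc_closed (m n : ℕ) : (m*n+1) * fc m n = Nat.choose ((m+1)*n) n := by
  have h := fcA_closed m n 1
  have h2 := Nat.add_one_mul_choose_eq ((m+1)*n) n
  have h3 := Nat.choose_mul_succ_eq ((m+1)*n) n
  have e : 1 + n*(m+1) = (m+1)*n+1 := by ring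
  rw [e] at h
  have e2 : (m+1)*n + 1 - n = m*n+1 := by
    have : (m+1)*n + 1 = (m*n+1) + n := by ring
    omega
  rw [e2] at h3
  apply Nat.eq_of_mul_eq_mul_left (Nat.succ_pos ((m+1)*n))
  unfold fc
  simp only [Nat.succ_eq_add_one]
  linear_combination (m*n+1) * h - h3

lemma fc_rec (m n : ℕ) (hn : 1 ≤ n) : ∑ i ∈ Finset.Ico 1 n, (m*(n-i)+1) * (fc m i * fc m (n-i)) = (n-1) * fc m n := by
  have hrefl : ∑ i ∈ Finset.Ico 1 n, (m*(n-i)+1) * (fc m i * fc m (n-i)) = 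
    ∑ i ∈ Finset.Ico 1 n, (m*i+1) * (fc m i * fc m (n-i)) := by
    apply Finset.sum_nbij' (fun i => n - i) (fun i => n - i)
    · intro i hi; simp at hi ⊢; omega
    · intro i hi; simp at hi ⊢; omega
    · intro i hi; simp at hi ⊢; omega
    · intro i hi; simp at hi ⊢; omega
    · intro i hi
      simp at hi
      have : n - (n - i) = i := by omega
      rw [this]; ring
  have hsum : 2 * ∑ i ∈ Finset.Ico 1 n, (m*(n-i)+1) * (fc m i * fc m (n-i)) = 
      (m*n+2) * ∑ i ∈ Finset.Ico 1 n, (fc m i * fc m (n-i)) := by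
    rw [two_mul]
    nth_rewrite 2 [hrefl]
    rw [← Finset.sum_add_distrib, Finset.mul_sum]
    apply Finset.sum_congr rfl
    intro i hi
    simp at hi
    obtain ⟨r, rfl⟩ := Nat.exists_eq_add_of_le hi.2.le
    simp only [Nat.add_sub_cancel_left]
    ring
  have hconv := fcA_conv (m+1) n 1 1
  rw [Finset.sum_range_succ, Finset.range_eq_Ico, Finset.sum_eq_sum_Ico_succ_bot (by omega)] at hconv
  change fc m 0 * fc m (n-0) + ∑ i ∈ Finset.Ico 1 n, fc m i * fc m (n-i) + fc m n * fc m (n-n) = _ at hconv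
  simp only [Nat.sub_zero, Nat.sub_self, fc_zero, one_mul, mul_one] at hconv
  have hcl := fcA_closed m n 2
  have h1 := fc_closed m n
  have e : (1+1) = 2 := rfl
  rw [e] at hconv
  rw [← hconv] at hcl
  -- relate choose (2+K) n with choose K n
  set K := (m+1)*n with hK
  have hK' : n*(m+1) = K := by rw [hK]; ring
  rw [hK'] at hcl
  have c1 := Nat.choose_mul_succ_eq K n
  have c2 := Nat.choose_mul_succ_eq (K+1) n
  have hKn : K = m*n + n := by rw [hK]; ring
  have e1 : K + 1 - n = m*n+1 := by omega
  have e2 : K + 1 + 1 - n = m*n+2 := by omega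
  rw [e1] at c1; rw [e2] at c2
  have e3 : 2 + K = K+1+1 := by ring
  rw [e3] at hcl
  set Q := ∑ i ∈ Finset.Ico 1 n, fc m i * fc m (n-i)
  set F := fc m n
  -- (K+1+1) * (F+Q+F) * (mn+2) = 2 * C(K+2,n) (mn+2) = 2 * C(K+1,n) (K+2)
  have d1 : (m*n+2) * (2*F + Q) = 2 * (K+1).choose n := by
    apply Nat.eq_of_mul_eq_mul_left (Nat.succ_pos (K+1))
    simp only [Nat.succ_eq_add_one]
    linear_combination (m*n+2) * hcl - 2 * c2
  have d2 : (K+1).choose n = F * (K+1) := by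
    apply Nat.eq_of_mul_eq_mul_left (Nat.succ_pos (m*n))
    simp only [Nat.succ_eq_add_one]
    linear_combination - c1 - (K+1) * h1
  rw [d2] at d1
  apply Nat.eq_of_mul_eq_mul_left (Nat.succ_pos 1)
  simp only [Nat.succ_eq_add_one]
  rw [e, hsum]
  obtain ⟨r, rfl⟩ := Nat.exists_eq_add_of_le hn
  simp only [Nat.add_sub_cancel_left]
  linear_combination d1 + 2 * F * hKn

open Classical in
/-- Maximal independent subsets of `D` with respect to the relation `X`. -/
noncomputable def Mx {α : Type} (X : α → α → Prop) (D : Finset α) : Finset (Finset α) :=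
  D.powerset.filter (fun S => ∀ f ∈ D, f ∈ S ↔ ∀ g ∈ S, ¬ X f g)

lemma mem_Mx {α : Type} {X : α → α → Prop} {D S : Finset α} :
    S ∈ Mx X D ↔ S ⊆ D ∧ ∀ f ∈ D, f ∈ S ↔ ∀ g ∈ S, ¬ X f g := by
  simp [Mx]

lemma Mx_empty {α : Type} (X : α → α → Prop) : Mx X (∅ : Finset α) = {∅} := by
  ext S; rw [mem_Mx]; simp

section
open Classical

lemma Mx_cut_mem {α : Type} {X : α → α → Prop} (hs : ∀ f g, X f g → X g f)
    {D D1 D2 : Finset α} {e : α} (h1 : D1 ⊆ D) (h2 : D2 ⊆ D)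
    (he1 : e ∉ D1) (he2 : e ∉ D2) (hd : ∀ f ∈ D1, f ∉ D2)
    (hc : ∀ f ∈ D, f ≠ e → ¬ X f e → f ∈ D1 ∨ f ∈ D2)
    (hx1 : ∀ f ∈ D1, ¬ X f e) (hx2 : ∀ f ∈ D2, ¬ X f e)
    (hx : ∀ f ∈ D1, ∀ g ∈ D2, ¬ X f g) {S : Finset α} (hS : S ∈ Mx X D) (heS : e ∈ S) :
    S ∩ D1 ∈ Mx X D1 ∧ S ∩ D2 ∈ Mx X D2 ∧ S = insert e (S ∩ D1 ∪ S ∩ D2) ∧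
      S.card = (S ∩ D1).card + (S ∩ D2).card + 1 := by
  rw [mem_Mx] at hS
  obtain ⟨hSD, hS⟩ := hS
  have hdec : ∀ g ∈ S, g = e ∨ g ∈ D1 ∨ g ∈ D2 := by
    intro g hg
    by_cases h : g = e
    · exact Or.inl h
    · exact Or.inr (hc g (hSD hg) h ((hS g (hSD hg)).1 hg e heS))
  have heq : S = insert e (S ∩ D1 ∪ S ∩ D2) := by
    ext g
    simp only [Finset.mem_insert, Finset.mem_union, Finset.mem_inter]
    constructor
    · intro hg
      rcases hdec g hg with h | h | h <;> tauto
    · rintro (rfl | h | h) <;> tauto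
  refine ⟨?_, ?_, heq, ?_⟩
  · rw [mem_Mx]
    refine ⟨Finset.inter_subset_right, fun f hf => ?_⟩
    rw [Finset.mem_inter, hS f (h1 hf)]
    constructor
    · intro h g hg
      exact h.1 g (Finset.mem_inter.1 hg).1
    · intro h
      refine ⟨fun g hg => ?_, hf⟩
      rcases hdec g hg with rfl | h' | h'
      · exact hx1 f hf
      · exact h g (Finset.mem_inter.2 ⟨hg, h'⟩)
      · exact hx f hf g h'
  · rw [mem_Mx]
    refine ⟨Finset.inter_subset_right, fun f hf => ?_⟩
    rw [Finset.mem_inter, hS f (h2 hf)]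
    constructor
    · intro h g hg
      exact h.1 g (Finset.mem_inter.1 hg).1
    · intro h
      refine ⟨fun g hg => ?_, hf⟩
      rcases hdec g hg with rfl | h' | h'
      · exact hx2 f hf
      · exact fun hh => hx g h' f hf (hs _ _ hh)
      · exact h g (Finset.mem_inter.2 ⟨hg, h'⟩)
  · conv_lhs => rw [heq]
    rw [Finset.card_insert_of_notMem (by simp [he1, he2]), Finset.card_union_of_disjoint]
    rw [Finset.disjoint_left]
    intro f hf hf'
    exact hd f (Finset.mem_inter.1 hf).2 (Finset.mem_inter.1 hf').2

lemma Mx_cut_card {α : Type} {X : α → α → Prop} (hs : ∀ f g, X f g → X g f)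
    {D D1 D2 : Finset α} {e : α} (heD : e ∈ D) (hee : ¬ X e e) (h1 : D1 ⊆ D) (h2 : D2 ⊆ D)
    (he1 : e ∉ D1) (he2 : e ∉ D2) (hd : ∀ f ∈ D1, f ∉ D2)
    (hc : ∀ f ∈ D, f ≠ e → ¬ X f e → f ∈ D1 ∨ f ∈ D2)
    (hx1 : ∀ f ∈ D1, ¬ X f e) (hx2 : ∀ f ∈ D2, ¬ X f e)
    (hx : ∀ f ∈ D1, ∀ g ∈ D2, ¬ X f g) :
    ((Mx X D).filter (fun S => e ∈ S)).card = (Mx X D1).card * (Mx X D2).card := by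
  rw [← Finset.card_product]
  have hd' : ∀ f ∈ D2, f ∉ D1 := fun f hf hf' => hd f hf' hf
  apply Finset.card_nbij' (fun S => (S ∩ D1, S ∩ D2)) (fun P => insert e (P.1 ∪ P.2))
  · intro S hS
    simp only [Finset.coe_filter, Set.mem_ofPred_eq] at hS
    have := Mx_cut_mem hs h1 h2 he1 he2 hd hc hx1 hx2 hx hS.1 hS.2
    simp only [Finset.mem_coe, Finset.mem_product]
    exact ⟨this.1, this.2.1⟩
  · rintro ⟨A, B⟩ hP
    simp only [Finset.mem_coe, Finset.mem_product, mem_Mx] at hP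
    obtain ⟨⟨hA, hA'⟩, hB, hB'⟩ := hP
    simp only [Finset.coe_filter, Set.mem_ofPred_eq, mem_Mx, Finset.mem_insert_self, and_true]
    constructor
    · intro f hf
      simp only [Finset.mem_insert, Finset.mem_union] at hf
      rcases hf with rfl | hf | hf
      · exact heD
      · exact h1 (hA hf)
      · exact h2 (hB hf)
    · intro f hf
      simp only [Finset.mem_insert, Finset.mem_union]
      constructor
      · rintro h g h'
        rcases h with rfl | h | h <;> rcases h' with rfl | h' | h'
        · exact hee
        · exact fun hh => hx1 _ (hA h') (hs _ _ hh)
        · exact fun hh => hx2 _ (hB h') (hs _ _ hh)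
        · exact hx1 _ (hA h)
        · exact (hA' f (hA h)).1 h g h'
        · exact hx _ (hA h) _ (hB h')
        · exact hx2 _ (hB h)
        · exact fun hh => hx _ (hA h') _ (hB h) (hs _ _ hh)
        · exact (hB' f (hB h)).1 h g h'
      · intro h
        by_cases hfe : f = e
        · exact Or.inl hfe
        right
        rcases hc f hf hfe (h e (Or.inl rfl)) with h' | h'
        · left; exact (hA' f h').2 (fun g hg => h g (by tauto))
        · right; exact (hB' f h').2 (fun g hg => h g (by tauto))
  · intro S hS
    simp only [Finset.coe_filter, Set.mem_ofPred_eq] at hS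
    exact (Mx_cut_mem hs h1 h2 he1 he2 hd hc hx1 hx2 hx hS.1 hS.2).2.2.1.symm
  · rintro ⟨A, B⟩ hP
    simp only [Finset.mem_coe, Finset.mem_product, mem_Mx] at hP
    obtain ⟨⟨hA, -⟩, hB, -⟩ := hP
    ext f
    · simp only [Finset.mem_inter, Finset.mem_insert, Finset.mem_union]
      constructor
      · rintro ⟨rfl | h | h, h'⟩
        · exact absurd h' he1
        · exact h
        · exact absurd (hB h) (hd f h')
      · intro h; exact ⟨by tauto, hA h⟩
    · simp only [Finset.mem_inter, Finset.mem_insert, Finset.mem_union]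
      constructor
      · rintro ⟨rfl | h | h, h'⟩
        · exact absurd h' he2
        · exact absurd h' (hd f (hA h))
        · exact h
      · intro h; exact ⟨by tauto, hB h⟩

lemma Mx_nonempty_mem {α : Type} {X : α → α → Prop} {D : Finset α} {e : α}
    (heD : e ∈ D) {S : Finset α} (hS : S ∈ Mx X D) : S.Nonempty := by
  rw [mem_Mx] at hS
  by_contra h
  rw [Finset.not_nonempty_iff_eq_empty] at h
  subst h
  have := (hS.2 e heD).2 (by simp)
  simp at this

lemma Mx_sum {α : Type} (X : α → α → Prop) (D : Finset α) :
    ∑ S ∈ Mx X D, S.card = ∑ e ∈ D, ((Mx X D).filter (fun S => e ∈ S)).card := by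
  have : ∀ S ∈ Mx X D, S.card = (D.filter (fun e => e ∈ S)).card := by
    intro S hS
    congr 1
    ext e
    have := (mem_Mx.1 hS).1
    simp only [Finset.mem_filter]
    exact ⟨fun h => ⟨this h, h⟩, fun h => h.2⟩
  rw [Finset.sum_congr rfl this]
  exact Finset.sum_card_bipartiteAbove_eq_sum_card_bipartiteBelow (fun S e => e ∈ S)

end

/-- number of points strictly between -/
def nbt (V : Finset ℕ) (a b : ℕ) : ℕ := (V.filter (fun x => a < x ∧ x < b)).card

/-- the m-diagonals of the polygon with vertex set V -/
def Dg (m : ℕ) (V : Finset ℕ) : Finset (ℕ × ℕ) :=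
  (V ×ˢ V).filter (fun p => p.1 < p.2 ∧ m ∣ nbt V p.1 p.2 ∧ nbt V p.1 p.2 ≠ 0 ∧
    nbt V p.1 p.2 + 2 ≠ V.card)

lemma mem_Dg {m : ℕ} {V : Finset ℕ} {a b : ℕ} : (a, b) ∈ Dg m V ↔
    a ∈ V ∧ b ∈ V ∧ a < b ∧ m ∣ nbt V a b ∧ nbt V a b ≠ 0 ∧ nbt V a b + 2 ≠ V.card := by
  simp [Dg, and_assoc]

/-- crossing -/
def crs (p q : ℕ × ℕ) : Prop :=
  (p.1 < q.1 ∧ q.1 < p.2 ∧ p.2 < q.2) ∨ (q.1 < p.1 ∧ p.1 < q.2 ∧ q.2 < p.2)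

/-- inner part -/
def inn (V : Finset ℕ) (a b : ℕ) : Finset ℕ := V.filter (fun x => a ≤ x ∧ x ≤ b)
/-- outer part -/
def out (V : Finset ℕ) (a b : ℕ) : Finset ℕ := V.filter (fun x => ¬ (a < x ∧ x < b))

lemma card_inn {V : Finset ℕ} {a b : ℕ} (ha : a ∈ V) (hb : b ∈ V) (hab : a < b) :
    (inn V a b).card = nbt V a b + 2 := by
  have : inn V a b = insert a (insert b (V.filter (fun x => a < x ∧ x < b))) := by
    ext x
    simp only [inn, Finset.mem_filter, Finset.mem_insert]
    constructor
    · rintro ⟨h1, h2, h3⟩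
      have : x = a ∨ x = b ∨ (a < x ∧ x < b) := by omega
      tauto
    · rintro (rfl | rfl | ⟨h1, h2, h3⟩)
      · exact ⟨ha, le_refl _, hab.le⟩
      · exact ⟨hb, hab.le, le_refl _⟩
      · exact ⟨h1, h2.le, h3.le⟩
  rw [this, Finset.card_insert_of_notMem, Finset.card_insert_of_notMem, nbt]
  · simp
  · simp [hab.ne]

lemma card_out (V : Finset ℕ) (a b : ℕ) : (out V a b).card + nbt V a b = V.card := by
  rw [add_comm]
  exact Finset.card_filter_add_card_filter_not _

lemma nbt_inn {V : Finset ℕ} {a b c d : ℕ} (h1 : a ≤ c) (h2 : d ≤ b) :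
    nbt (inn V a b) c d = nbt V c d := by
  unfold nbt inn
  congr 1
  ext x
  simp only [Finset.mem_filter]
  constructor
  · tauto
  · rintro ⟨h, h', h''⟩; exact ⟨⟨h, by omega, by omega⟩, h', h''⟩

lemma nbt_out {V : Finset ℕ} {a b c d : ℕ} (h : d ≤ a ∨ b ≤ c) :
    nbt (out V a b) c d = nbt V c d := by
  unfold nbt out
  congr 1
  ext x
  simp only [Finset.mem_filter]
  constructor
  · tauto
  · rintro ⟨h, h', h''⟩; exact ⟨⟨h, by omega⟩, h', h''⟩

lemma nbt_out' {V : Finset ℕ} {a b c d : ℕ} (h : c ≤ a) (h' : b ≤ d) :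
    nbt (out V a b) c d + nbt V a b = nbt V c d := by
  unfold nbt out
  rw [← Finset.card_union_of_disjoint]
  · congr 1
    ext x
    simp only [Finset.mem_filter, Finset.mem_union]
    constructor
    · rintro (⟨⟨h1, h2⟩, h3, h4⟩ | ⟨h1, h2, h3⟩)
      · exact ⟨h1, h3, h4⟩
      · exact ⟨h1, by omega, by omega⟩
    · rintro ⟨h1, h2, h3⟩
      by_cases hx : a < x ∧ x < b
      · exact Or.inr ⟨h1, hx⟩
      · exact Or.inl ⟨⟨h1, hx⟩, h2, h3⟩
  · rw [Finset.disjoint_left]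
    intro x hx hx'
    simp only [Finset.mem_filter] at hx hx'
    tauto

lemma nbt_le {V : Finset ℕ} {a b : ℕ} (ha : a ∈ V) (hb : b ∈ V) (hab : a < b) :
    nbt V a b + 2 ≤ V.card := by
  rw [← card_inn ha hb hab]
  exact Finset.card_le_card (Finset.filter_subset _ _)

lemma mem_inn {V : Finset ℕ} {a b x : ℕ} : x ∈ inn V a b ↔ x ∈ V ∧ a ≤ x ∧ x ≤ b := by
  simp [inn]
lemma mem_out {V : Finset ℕ} {a b x : ℕ} : x ∈ out V a b ↔ x ∈ V ∧ ¬ (a < x ∧ x < b) := by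
  simp only [out, Finset.mem_filter]

structure CutData (m : ℕ) (V : Finset ℕ) (a b : ℕ) : Prop where
  h1 : Dg m (inn V a b) ⊆ Dg m V
  h2 : Dg m (out V a b) ⊆ Dg m V
  he1 : (a, b) ∉ Dg m (inn V a b)
  he2 : (a, b) ∉ Dg m (out V a b)
  hd : ∀ f ∈ Dg m (inn V a b), f ∉ Dg m (out V a b)
  hc : ∀ f ∈ Dg m V, f ≠ (a, b) → ¬ crs f (a, b) → f ∈ Dg m (inn V a b) ∨ f ∈ Dg m (out V a b)
  hx1 : ∀ f ∈ Dg m (inn V a b), ¬ crs f (a, b)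
  hx2 : ∀ f ∈ Dg m (out V a b), ¬ crs f (a, b)
  hx : ∀ f ∈ Dg m (inn V a b), ∀ g ∈ Dg m (out V a b), ¬ crs f g

lemma cutData {m : ℕ} {V : Finset ℕ} {a b : ℕ} (h : (a, b) ∈ Dg m V) : CutData m V a b := by
  rw [mem_Dg] at h
  obtain ⟨ha, hb, hab, hdvd, hne, hne2⟩ := h
  have hci := card_inn ha hb hab
  have hco := card_out V a b
  have hle := nbt_le ha hb hab
  have he1 : (a, b) ∉ Dg m (inn V a b) := by
    rw [mem_Dg, nbt_inn le_rfl le_rfl, hci]; tauto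
  have he2 : (a, b) ∉ Dg m (out V a b) := by
    have := nbt_out' (V := V) (le_refl a) (le_refl b)
    rw [mem_Dg]; rintro ⟨-, -, -, -, h, -⟩; omega
  have hout : ∀ c d, c < d → c ∈ out V a b → d ∈ out V a b → (d ≤ a ∨ b ≤ c) ∨ (c ≤ a ∧ b ≤ d) := by
    intro c d hcd hc hd
    rw [mem_out] at hc hd
    omega
  refine ⟨?_, ?_, he1, he2, ?_, ?_, ?_, ?_, ?_⟩
  · rintro ⟨c, d⟩ h
    rw [mem_Dg] at h ⊢
    obtain ⟨hc, hd, hcd, h1, h2, h3⟩ := h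
    have hl := nbt_le hc hd hcd
    rw [mem_inn] at hc hd
    rw [nbt_inn hc.2.1 hd.2.2] at h1 h2 h3 hl
    exact ⟨hc.1, hd.1, hcd, h1, h2, by omega⟩
  · rintro ⟨c, d⟩ h
    rw [mem_Dg] at h ⊢
    obtain ⟨hc, hd, hcd, h1, h2, h3⟩ := h
    have hl := nbt_le hc hd hcd
    have hcases := hout c d hcd hc hd
    rw [mem_out] at hc hd
    rcases hcases with h | h
    · rw [nbt_out h] at h1 h2 h3 hl
      exact ⟨hc.1, hd.1, hcd, h1, h2, by omega⟩
    · have e := nbt_out' (V := V) h.1 h.2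
      refine ⟨hc.1, hd.1, hcd, ?_, by omega, by omega⟩
      rw [← e]; exact dvd_add h1 hdvd
  · rintro ⟨c, d⟩ h h'
    have hne : (c, d) ≠ (a, b) := fun hh => he1 (hh ▸ h)
    rw [mem_Dg, mem_inn, mem_inn] at h
    rw [mem_Dg, mem_out, mem_out] at h'
    apply hne
    rw [Prod.mk.injEq]
    omega
  · rintro ⟨c, d⟩ h hn hx
    rw [mem_Dg] at h
    obtain ⟨hc, hd, hcd, h1, h2, h3⟩ := h
    have hl := nbt_le hc hd hcd
    simp only [crs] at hx
    rw [Ne, Prod.mk.injEq] at hn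
    by_cases hi : a ≤ c ∧ d ≤ b
    · left
      rw [mem_Dg, mem_inn, mem_inn, nbt_inn hi.1 hi.2]
      refine ⟨⟨hc, by omega⟩, ⟨hd, by omega⟩, hcd, h1, h2, ?_⟩
      intro h
      -- equal card forces equality
      have hs : inn V c d ⊆ inn V a b := by
        intro x; rw [mem_inn, mem_inn]; rintro ⟨p, q, r⟩; exact ⟨p, by omega, by omega⟩
      have := Finset.eq_of_subset_of_card_le hs (by rw [card_inn hc hd hcd]; omega)
      have ha' : a ∈ inn V c d := by rw [this, mem_inn]; exact ⟨ha, le_rfl, hab.le⟩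
      have hb' : b ∈ inn V c d := by rw [this, mem_inn]; exact ⟨hb, hab.le, le_rfl⟩
      rw [mem_inn] at ha' hb'
      omega
    · right
      have hcases : (d ≤ a ∨ b ≤ c) ∨ (c ≤ a ∧ b ≤ d) := by omega
      rw [mem_Dg, mem_out, mem_out]
      refine ⟨⟨hc, by omega⟩, ⟨hd, by omega⟩, hcd, ?_⟩
      rcases hcases with h | h
      · rw [nbt_out h]
        refine ⟨h1, h2, ?_⟩
        intro heq
        have hs : inn V c d ⊆ out V a b := by
          intro x; rw [mem_inn, mem_out]; rintro ⟨p, q, r⟩; exact ⟨p, by omega⟩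
        have := Finset.eq_of_subset_of_card_le hs (by rw [card_inn hc hd hcd]; omega)
        have ha' : a ∈ inn V c d := by rw [this, mem_out]; exact ⟨ha, by omega⟩
        have hb' : b ∈ inn V c d := by rw [this, mem_out]; exact ⟨hb, by omega⟩
        rw [mem_inn] at ha' hb'
        omega
      · have e := nbt_out' (V := V) h.1 h.2
        refine ⟨?_, ?_, by omega⟩
        · rw [← e] at h1; exact (Nat.dvd_add_left hdvd).1 h1
        · intro h0
          have hs : inn V a b ⊆ inn V c d := by
            intro x; rw [mem_inn, mem_inn]; rintro ⟨p, q, r⟩; exact ⟨p, by omega, by omega⟩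
          have := Finset.eq_of_subset_of_card_le hs (by rw [card_inn hc hd hcd]; omega)
          have ha' : c ∈ inn V a b := by rw [this, mem_inn]; exact ⟨hc, le_rfl, hcd.le⟩
          have hb' : d ∈ inn V a b := by rw [this, mem_inn]; exact ⟨hd, hcd.le, le_rfl⟩
          rw [mem_inn] at ha' hb'
          omega
  · rintro ⟨c, d⟩ h
    rw [mem_Dg, mem_inn, mem_inn] at h
    simp only [crs]; omega
  · rintro ⟨c, d⟩ h
    rw [mem_Dg, mem_out, mem_out] at h
    simp only [crs]; omega
  · rintro ⟨c, d⟩ h ⟨c', d'⟩ h'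
    rw [mem_Dg, mem_inn, mem_inn] at h
    rw [mem_Dg, mem_out, mem_out] at h'
    simp only [crs]; omega

lemma crs_symm (f g : ℕ × ℕ) (h : crs f g) : crs g f := by
  unfold crs at *; omega

/-- rank -/
def rk (V : Finset ℕ) (x : ℕ) : ℕ := (V.filter (fun y => y < x)).card

lemma rk_add {V : Finset ℕ} {a b : ℕ} (ha : a ∈ V) (hab : a < b) :
    rk V b = rk V a + 1 + nbt V a b := by
  have h : V.filter (fun y => y < b) =
      (insert a (V.filter (fun y => y < a))) ∪ V.filter (fun x => a < x ∧ x < b) := by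
    ext x
    simp only [Finset.mem_filter, Finset.mem_union, Finset.mem_insert]
    constructor
    · rintro ⟨h1, h2⟩
      have : x = a ∨ x < a ∨ a < x := by omega
      tauto
    · rintro ((rfl | ⟨h1, h2⟩) | ⟨h1, h2, h3⟩)
      · exact ⟨ha, hab⟩
      · exact ⟨h1, by omega⟩
      · exact ⟨h1, h3⟩
  unfold rk nbt
  rw [h, Finset.card_union_of_disjoint, Finset.card_insert_of_notMem]
  · simp
  · rw [Finset.disjoint_left]
    intro x hx hx'
    simp only [Finset.mem_filter, Finset.mem_insert] at hx hx'
    omega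

lemma rk_inj {V : Finset ℕ} {a b : ℕ} (ha : a ∈ V) (hb : b ∈ V) (h : rk V a = rk V b) : a = b := by
  rcases lt_trichotomy a b with h' | h' | h'
  · have := rk_add ha h'; omega
  · exact h'
  · have := rk_add hb h'; omega

lemma rk_lt {V : Finset ℕ} {a : ℕ} (ha : a ∈ V) : rk V a < V.card := by
  apply Finset.card_lt_card
  rw [Finset.ssubset_iff_of_subset (Finset.filter_subset _ _)]
  exact ⟨a, ha, by simp⟩

lemma rk_surj {V : Finset ℕ} {j : ℕ} (hj : j < V.card) : ∃ a ∈ V, rk V a = j := by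
  have h : V.image (rk V) = Finset.range V.card := by
    apply Finset.eq_of_subset_of_card_le
    · intro x hx
      simp only [Finset.mem_image] at hx
      obtain ⟨a, ha, rfl⟩ := hx
      simpa using rk_lt ha
    · rw [Finset.card_image_of_injOn, Finset.card_range]
      intro a ha b hb hab
      exact rk_inj ha hb hab
  have : j ∈ V.image (rk V) := by rw [h]; simpa
  simpa using this

lemma card_pairs (V : Finset ℕ) (k : ℕ) :
    ((V ×ˢ V).filter (fun p => p.1 < p.2 ∧ nbt V p.1 p.2 = k)).card = V.card - (k + 1) := by
  rw [← Finset.card_range (V.card - (k+1))]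
  apply Finset.card_nbij (fun p => rk V p.1)
  · rintro ⟨a, b⟩ hp
    simp only [Finset.coe_filter, Set.mem_ofPred_eq, Finset.mem_product] at hp
    obtain ⟨⟨ha, hb⟩, hab, hk⟩ := hp
    have := rk_add ha hab
    have := rk_lt hb
    simp only [Finset.coe_range, Set.mem_Iio]
    omega
  · rintro ⟨a, b⟩ hp ⟨a', b'⟩ hp' h
    simp only [Finset.coe_filter, Set.mem_ofPred_eq, Finset.mem_product] at hp hp'
    obtain ⟨⟨ha, hb⟩, hab, hk⟩ := hp
    obtain ⟨⟨ha', hb'⟩, hab', hk'⟩ := hp'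
    have h1 := rk_add ha hab
    have h2 := rk_add ha' hab'
    simp only at h
    have e1 := rk_inj ha ha' h
    have e2 := rk_inj hb hb' (by omega)
    rw [e1, e2]
  · intro j hj
    simp only [Finset.coe_range, Set.mem_Iio] at hj
    obtain ⟨a, ha, hra⟩ := rk_surj (V := V) (j := j) (by omega)
    obtain ⟨b, hb, hrb⟩ := rk_surj (V := V) (j := j + 1 + k) (by omega)
    refine ⟨(a, b), ?_, hra⟩
    simp only [Finset.coe_filter, Set.mem_ofPred_eq, Finset.mem_product]
    have hab : a < b := by
      rcases lt_trichotomy a b with h' | h' | h'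
      · exact h'
      · subst h'; omega
      · have := rk_add hb h'; omega
    have := rk_add ha hab
    exact ⟨⟨ha, hb⟩, hab, by omega⟩

lemma main_count (m : ℕ) (hm : 1 ≤ m) : ∀ n, 1 ≤ n → ∀ V : Finset ℕ, V.card = m * n + 2 →
    (Mx crs (Dg m V)).card = fc m n ∧ ∀ S ∈ Mx crs (Dg m V), S.card = n - 1 := by
  intro n
  induction n using Nat.strong_induction_on with
  | _ n ih =>
  intro hn V hV
  -- every diagonal has a parameter i
  have hpar : ∀ e ∈ Dg m V, ∃ i, 1 ≤ i ∧ i < n ∧ nbt V e.1 e.2 = m * i := by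
    rintro ⟨a, b⟩ h
    rw [mem_Dg] at h
    obtain ⟨ha, hb, hab, ⟨i, hi⟩, h2, h3⟩ := h
    have hl := nbt_le ha hb hab
    refine ⟨i, ?_, ?_, hi⟩
    · rcases Nat.eq_zero_or_pos i with rfl | h
      · simp at hi; omega
      · exact h
    · have : m * i < m * n := by omega
      exact Nat.lt_of_mul_lt_mul_left this
  have hcut : ∀ e ∈ Dg m V, ∀ i, 1 ≤ i → i < n → nbt V e.1 e.2 = m * i →
      (inn V e.1 e.2).card = m * i + 2 ∧ (out V e.1 e.2).card = m * (n - i) + 2 := by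
    rintro ⟨a, b⟩ h i h1 h2 h3
    rw [mem_Dg] at h
    obtain ⟨ha, hb, hab, -⟩ := h
    have e1 := card_inn ha hb hab
    have e2 := card_out V a b
    simp only at h3 ⊢
    have : m * (n - i) + m * i = m * n := by rw [← mul_add]; congr 1; omega
    omega
  by_cases hn1 : n = 1
  · subst hn1
    have hemp : Dg m V = ∅ := by
      rw [Finset.eq_empty_iff_forall_notMem]
      intro e he
      obtain ⟨i, h1, h2, -⟩ := hpar e he
      omega
    rw [hemp, Mx_empty, fc_one]
    simp
  have hsize : ∀ S ∈ Mx crs (Dg m V), S.card = n - 1 := by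
    intro S hS
    -- there is a diagonal
    have hcp := card_pairs V m
    have hmn : m * 2 ≤ m * n := Nat.mul_le_mul_left m (by omega)
    have hpos : 0 < ((V ×ˢ V).filter (fun p => p.1 < p.2 ∧ nbt V p.1 p.2 = m)).card := by
      rw [hcp]; omega
    obtain ⟨e, he⟩ := Finset.card_pos.1 hpos
    have heD : e ∈ Dg m V := by
      simp only [Finset.mem_filter] at he
      simp only [Dg, Finset.mem_filter]
      refine ⟨he.1, he.2.1, ?_⟩
      rw [he.2.2]
      exact ⟨dvd_rfl, by omega, by omega⟩
    obtain ⟨⟨a, b⟩, hs⟩ := Mx_nonempty_mem heD hS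
    have hsD := (mem_Mx.1 hS).1 hs
    obtain ⟨i, h1, h2, h3⟩ := hpar _ hsD
    obtain ⟨c1, c2⟩ := hcut _ hsD i h1 h2 h3
    have C := cutData hsD
    obtain ⟨s1, s2, -, s3⟩ :=
      Mx_cut_mem crs_symm C.h1 C.h2 C.he1 C.he2 C.hd C.hc C.hx1 C.hx2 C.hx hS hs
    have t1 := (ih i h2 h1 _ c1).2 _ s1
    have t2 := (ih (n - i) (by omega) (by omega) _ c2).2 _ s2
    omega
  refine ⟨?_, hsize⟩
  have hsum := Mx_sum crs (Dg m V)
  rw [Finset.sum_congr rfl hsize, Finset.sum_const, smul_eq_mul] at hsum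
  have hfib : ∑ e ∈ Dg m V, ((Mx crs (Dg m V)).filter (fun S => e ∈ S)).card =
      ∑ i ∈ Finset.Ico 1 n, (m*(n-i)+1) * (fc m i * fc m (n-i)) := by
    rw [← Finset.sum_fiberwise_of_maps_to (s := Dg m V) (t := Finset.Ico 1 n)
      (g := fun e => nbt V e.1 e.2 / m)]
    · apply Finset.sum_congr rfl
      intro i hi
      rw [Finset.mem_Ico] at hi
      have hset : (Dg m V).filter (fun e => nbt V e.1 e.2 / m = i) =
          (V ×ˢ V).filter (fun p => p.1 < p.2 ∧ nbt V p.1 p.2 = m * i) := by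
        ext ⟨a, b⟩
        rw [Finset.mem_filter, mem_Dg, Finset.mem_filter, Finset.mem_product]
        constructor
        · rintro ⟨⟨ha, hb, hab, hd, -⟩, h⟩
          refine ⟨⟨ha, hb⟩, hab, ?_⟩
          rw [← h]; exact (Nat.mul_div_cancel' hd).symm
        · rintro ⟨⟨ha, hb⟩, hab, h⟩
          simp only at ha hb hab h ⊢
          rw [h]
          have l1 : m * i < m * n := Nat.mul_lt_mul_of_pos_left hi.2 hm
          have l2 : 0 < m * i := Nat.mul_pos hm hi.1
          exact ⟨⟨ha, hb, hab, dvd_mul_right _ _, by omega, by omega⟩,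
            Nat.mul_div_cancel_left _ hm⟩
      have hterm : ∀ e ∈ (Dg m V).filter (fun e => nbt V e.1 e.2 / m = i),
          ((Mx crs (Dg m V)).filter (fun S => e ∈ S)).card = fc m i * fc m (n - i) := by
        rintro ⟨a, b⟩ he
        have he' := he
        rw [hset, Finset.mem_filter] at he'
        have heD := (Finset.mem_filter.1 he).1
        obtain ⟨c1, c2⟩ := hcut _ heD i hi.1 hi.2 he'.2.2
        have C := cutData heD
        have := Mx_cut_card crs_symm heD (by simp [crs]) C.h1 C.h2 C.he1 C.he2 C.hd C.hc
          C.hx1 C.hx2 C.hx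
        have t1 := (ih i hi.2 hi.1 _ c1).1
        have t2 := (ih (n - i) (by omega) (by omega) _ c2).1
        simp only at t1 t2
        rw [t1, t2] at this
        rw [← this]
        congr!
      rw [Finset.sum_congr rfl hterm, Finset.sum_const, smul_eq_mul, hset, card_pairs, hV]
      congr 1
      have : m * (n - i) + m * i = m * n := by rw [← mul_add]; congr 1; omega
      omega
    · intro e he
      obtain ⟨i, h1, h2, h3⟩ := hpar e he
      rw [h3, Nat.mul_div_cancel_left _ hm, Finset.mem_Ico]
      exact ⟨h1, h2⟩
  rw [fc_rec m n hn] at hfib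
  have hfin : (n - 1) * (Mx crs (Dg m V)).card = (n - 1) * fc m n := by
    rw [← hfib, mul_comm, hsum]
    congr!
  exact Nat.eq_of_mul_eq_mul_left (by omega) hfin

lemma zval_sub {N : ℕ} [NeZero N] (a x : ZMod N) :
    (x - a).val = if a.val ≤ x.val then x.val - a.val else N + x.val - a.val := by
  have hN : 0 < N := Nat.pos_of_ne_zero (NeZero.ne N)
  have ha := ZMod.val_lt a
  have hx := ZMod.val_lt x
  split_ifs with h
  · exact ZMod.val_sub h
  · have : x - a = ((N + x.val - a.val : ℕ) : ZMod N) := by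
      rw [Nat.cast_sub (by omega)]
      simp
    rw [this, ZMod.val_natCast_of_lt (by omega)]

lemma inArc_iff {N : ℕ} [NeZero N] (a b x : ZMod N) :
    InOpenArc a b x ↔ 0 < (x - a).val ∧ (x - a).val < (b - a).val := by
  constructor
  · rintro ⟨k, h1, h2, rfl⟩
    have hb := ZMod.val_lt (b - a)
    rw [add_sub_cancel_left, ZMod.val_natCast_of_lt (by omega)]
    exact ⟨h1, h2⟩
  · rintro ⟨h1, h2⟩
    exact ⟨(x - a).val, h1, h2, by simp⟩

/-- the diagonal in the polygon -/
def phi (N : ℕ) (p : ℕ × ℕ) : Finset (ZMod N) := {(p.1 : ZMod N), (p.2 : ZMod N)}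

lemma fpair {α : Type} [DecidableEq α] {a b c d : α} (h : ({a, b} : Finset α) = {c, d}) :
    (a = c ∧ b = d) ∨ (a = d ∧ b = c) := by
  have : ({a, b} : Set α) = {c, d} := by
    have := congrArg (fun s : Finset α => (s : Set α)) h
    simpa using this
  exact Set.pair_eq_pair_iff.1 this

lemma phi_inj {N : ℕ} [NeZero N] {a b c d : ℕ} (hab : a < b) (hb : b < N) (hcd : c < d) (hd : d < N)
    (h : phi N (a, b) = phi N (c, d)) : (a, b) = (c, d) := by
  have ea := ZMod.val_natCast_of_lt (n := N) (a := a) (by omega)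
  have eb := ZMod.val_natCast_of_lt (n := N) (a := b) (by omega)
  have ec := ZMod.val_natCast_of_lt (n := N) (a := c) (by omega)
  have ed := ZMod.val_natCast_of_lt (n := N) (a := d) (by omega)
  rw [Prod.mk.injEq]
  rcases fpair h with ⟨h1, h2⟩ | ⟨h1, h2⟩ <;> simp only at h1 h2 <;> rw [h1] at ea <;>
    rw [h2] at eb <;> omega

lemma phi_cross {N : ℕ} [NeZero N] {a b c d : ℕ} (hab : a < b) (hb : b < N) (hcd : c < d)
    (hd : d < N) : Crosses (phi N (a, b)) (phi N (c, d)) ↔ crs (a, b) (c, d) := by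
  have ea := ZMod.val_natCast_of_lt (n := N) (a := a) (by omega)
  have eb := ZMod.val_natCast_of_lt (n := N) (a := b) (by omega)
  have ec := ZMod.val_natCast_of_lt (n := N) (a := c) (by omega)
  have ed := ZMod.val_natCast_of_lt (n := N) (a := d) (by omega)
  simp only [crs]
  constructor
  · rintro ⟨a', b', c', d', h1, h2, h3, h4⟩
    rw [inArc_iff] at h3 h4
    rcases fpair h1 with ⟨rfl, rfl⟩ | ⟨rfl, rfl⟩ <;> rcases fpair h2 with ⟨rfl, rfl⟩ | ⟨rfl, rfl⟩ <;>
    · simp only [zval_sub, ea, eb, ec, ed] at h3 h4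
      split_ifs at h3 h4 <;> omega
  · rintro (h | h)
    · refine ⟨a, b, c, d, rfl, rfl, ?_, ?_⟩ <;> rw [inArc_iff] <;>
      · simp only [zval_sub, ea, eb, ec, ed]
        split_ifs <;> omega
    · refine ⟨a, b, d, c, rfl, ?_, ?_, ?_⟩
      · simp only [phi]; exact Finset.pair_comm _ _
      all_goals
        rw [inArc_iff]
        simp only [zval_sub, ea, eb, ec, ed]
        split_ifs <;> omega

lemma nbt_range {N a b : ℕ} (hb : b < N) : nbt (Finset.range N) a b = b - a - 1 := by
  have : (Finset.range N).filter (fun x => a < x ∧ x < b) = Finset.Ioo a b := by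
    ext x; simp only [Finset.mem_filter, Finset.mem_range, Finset.mem_Ioo]; omega
  rw [nbt, this, Nat.card_Ioo]

lemma mem_Dg_range {m N a b : ℕ} : (a, b) ∈ Dg m (Finset.range N) ↔
    a < b ∧ b < N ∧ m ∣ b - a - 1 ∧ b - a - 1 ≠ 0 ∧ b - a - 1 + 2 ≠ N := by
  rw [mem_Dg, Finset.mem_range, Finset.mem_range, Finset.card_range]
  constructor
  · rintro ⟨h1, h2, h3, h4⟩
    rw [nbt_range h2] at h4; exact ⟨h3, h2, h4⟩
  · rintro ⟨h3, h2, h4⟩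
    rw [nbt_range h2]; exact ⟨by omega, h2, h3, h4⟩

lemma isMDiag_iff {m n : ℕ} (hm : 1 ≤ m) (d : Finset (ZMod (m * n + 2))) :
    IsMDiag m n d ↔ ∃ p ∈ Dg m (Finset.range (m * n + 2)), phi (m * n + 2) p = d := by
  have h1v : (1 : ZMod (m * n + 2)).val = 1 := by
    have := ZMod.val_natCast_of_lt (n := m * n + 2) (a := 1) (by omega)
    simpa using this
  constructor
  · rintro ⟨a, b, rfl, hab, h1, h2, i, hi1, hi2, hi⟩
    have hmi : m * i < m * n := Nat.mul_lt_mul_of_pos_left (by omega) hm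
    have hmi0 : 0 < m * i := Nat.mul_pos hm hi1
    have hmni : m * (n - i) + m * i = m * n := by rw [← mul_add]; congr 1; omega
    have hv := congrArg ZMod.val hi
    rw [ZMod.val_natCast_of_lt (by omega), zval_sub] at hv
    have ha := ZMod.val_lt a
    have hb := ZMod.val_lt b
    split_ifs at hv with hle
    · refine ⟨(a.val, b.val), ?_, by simp [phi]⟩
      rw [mem_Dg_range]
      have : b.val - a.val - 1 = m * i := by omega
      rw [this]
      exact ⟨by omega, hb, dvd_mul_right _ _, by omega, by omega⟩
    · refine ⟨(b.val, a.val), ?_, by simp [phi, Finset.pair_comm]⟩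
      rw [mem_Dg_range]
      have : a.val - b.val - 1 = m * (n - i) := by omega
      rw [this]
      exact ⟨by omega, ha, dvd_mul_right _ _, by omega, by omega⟩
  · rintro ⟨⟨a, b⟩, hp, rfl⟩
    rw [mem_Dg_range] at hp
    obtain ⟨hab, hb, ⟨i, hi⟩, h2, h3⟩ := hp
    have ea := ZMod.val_natCast_of_lt (n := m * n + 2) (a := a) (by omega)
    have eb := ZMod.val_natCast_of_lt (n := m * n + 2) (a := b) (by omega)
    refine ⟨a, b, rfl, ?_, ?_, ?_, i, ?_, ?_, ?_⟩
    · intro h; have := congrArg ZMod.val h; omega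
    · intro h; have := congrArg ZMod.val h
      rw [zval_sub, ea, eb, h1v] at this
      split_ifs at this <;> omega
    · intro h; have := congrArg ZMod.val h
      rw [zval_sub, ea, eb, h1v] at this
      split_ifs at this <;> omega
    · rcases Nat.eq_zero_or_pos i with rfl | h
      · simp at hi; omega
      · exact h
    · have : m * i < m * n := by omega
      have := Nat.lt_of_mul_lt_mul_left this
      omega
    · have : b = a + (m * i + 1) := by omega
      rw [this]; push_cast; ring

lemma isAng_iff {m n : ℕ} (hm : 1 ≤ m) (Δ : Finset (Finset (ZMod (m * n + 2)))) :
    IsAngulation m n Δ ↔ (∀ f ∈ Δ, IsMDiag m n f) ∧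
      ∀ f, IsMDiag m n f → (f ∈ Δ ↔ ∀ g ∈ Δ, ¬ Crosses f g) := by
  have key : ∀ f g, IsMDiag m n f → IsMDiag m n g → ∃ p q, (Crosses f g ↔ crs p q) ∧
      (Crosses g f ↔ crs q p) ∧ (Crosses f f ↔ crs p p) := by
    intro f g hf hg
    rw [isMDiag_iff hm] at hf hg
    obtain ⟨⟨a, b⟩, hp, rfl⟩ := hf
    obtain ⟨⟨c, d⟩, hq, rfl⟩ := hg
    rw [mem_Dg_range] at hp hq
    exact ⟨(a, b), (c, d), phi_cross hp.1 hp.2.1 hq.1 hq.2.1, phi_cross hq.1 hq.2.1 hp.1 hp.2.1,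
      phi_cross hp.1 hp.2.1 hp.1 hp.2.1⟩
  have hirr : ∀ f, IsMDiag m n f → ¬ Crosses f f := by
    intro f hf
    obtain ⟨p, q, -, -, h⟩ := key f f hf hf
    rw [h]; simp [crs]
  have hsym : ∀ f g, IsMDiag m n f → IsMDiag m n g → Crosses f g → Crosses g f := by
    intro f g hf hg
    obtain ⟨p, q, h1, h2, -⟩ := key f g hf hg
    rw [h1, h2]; exact crs_symm p q
  constructor
  · rintro ⟨⟨hD, hnc⟩, hmax⟩
    refine ⟨hD, fun f hf => ⟨fun hfΔ g hg => ?_, fun h => ?_⟩⟩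
    · by_cases hfg : f = g
      · subst hfg; exact hirr f hf
      · exact hnc f hfΔ g hg hfg
    · have := hmax (insert f Δ) ⟨?_, ?_⟩ (Finset.subset_insert _ _)
      · rw [← this]; exact Finset.mem_insert_self _ _
      · intro g hg
        rcases Finset.mem_insert.1 hg with rfl | hg
        · exact hf
        · exact hD g hg
      · intro x hx y hy hxy
        rcases Finset.mem_insert.1 hx with rfl | hx1 <;> rcases Finset.mem_insert.1 hy with rfl | hy1
        · exact absurd rfl hxy
        · exact h y hy1
        · exact fun hh => h x hx1 (hsym _ _ (hD x hx1) hf hh)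
        · exact hnc x hx1 y hy1 hxy
  · rintro ⟨hD, h⟩
    refine ⟨⟨hD, fun f hf g hg _ => (h f (hD f hf)).1 hf g hg⟩, ?_⟩
    rintro S' ⟨hS1, hS2⟩ hsub
    refine Finset.Subset.antisymm ?_ hsub
    intro f hf
    refine (h f (hS1 f hf)).2 (fun g hg => ?_)
    by_cases hfg : f = g
    · subst hfg; exact hirr f (hS1 f hf)
    · exact hS2 f hf g (hsub hg) hfg

lemma ang_eq_image {m n : ℕ} (hm : 1 ≤ m) :
    {Δ : Finset (Finset (ZMod (m * n + 2))) | IsAngulation m n Δ} =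
      (fun S : Finset (ℕ × ℕ) => S.image (phi (m * n + 2))) ''
        (Mx crs (Dg m (Finset.range (m * n + 2))) : Set (Finset (ℕ × ℕ))) := by
  set N := m * n + 2 with hN
  have hcr : ∀ p ∈ Dg m (Finset.range N), ∀ q ∈ Dg m (Finset.range N),
      (Crosses (phi N p) (phi N q) ↔ crs p q) := by
    rintro ⟨a, b⟩ hp ⟨c, d⟩ hq
    rw [mem_Dg_range] at hp hq
    exact phi_cross hp.1 hp.2.1 hq.1 hq.2.1
  have hinj : ∀ p ∈ Dg m (Finset.range N), ∀ q ∈ Dg m (Finset.range N),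
      phi N p = phi N q → p = q := by
    rintro ⟨a, b⟩ hp ⟨c, d⟩ hq h
    rw [mem_Dg_range] at hp hq
    exact phi_inj hp.1 hp.2.1 hq.1 hq.2.1 h
  ext Δ
  simp only [Set.mem_ofPred_eq, Set.mem_image, Finset.mem_coe]
  rw [isAng_iff hm]
  constructor
  · rintro ⟨hD, h⟩
    have himg : ((Dg m (Finset.range N)).filter (fun p => phi N p ∈ Δ)).image (phi N) = Δ := by
      ext f
      simp only [Finset.mem_image, Finset.mem_filter]
      constructor
      · rintro ⟨p, ⟨hp, hp'⟩, rfl⟩; exact hp'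
      · intro hf
        obtain ⟨p, hp, rfl⟩ := (isMDiag_iff hm f).1 (hD f hf)
        exact ⟨p, ⟨hp, hf⟩, rfl⟩
    refine ⟨_, ?_, himg⟩
    rw [mem_Mx]
    refine ⟨Finset.filter_subset _ _, fun p hp => ?_⟩
    rw [Finset.mem_filter, h _ ((isMDiag_iff hm _).2 ⟨p, hp, rfl⟩)]
    constructor
    · rintro ⟨-, h'⟩ q hq
      rw [Finset.mem_filter] at hq
      rw [← hcr p hp q hq.1]
      exact h' _ hq.2
    · intro h'
      refine ⟨hp, fun g hg => ?_⟩
      obtain ⟨q, hq, rfl⟩ := (isMDiag_iff hm g).1 (hD g hg)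
      rw [hcr p hp q hq]
      exact h' q (Finset.mem_filter.2 ⟨hq, hg⟩)
  · rintro ⟨S, hS, rfl⟩
    rw [mem_Mx] at hS
    obtain ⟨hSD, hS⟩ := hS
    constructor
    · intro f hf
      obtain ⟨p, hp, rfl⟩ := Finset.mem_image.1 hf
      exact (isMDiag_iff hm _).2 ⟨p, hSD hp, rfl⟩
    · intro f hf
      obtain ⟨p, hp, rfl⟩ := (isMDiag_iff hm f).1 hf
      have : phi N p ∈ S.image (phi N) ↔ p ∈ S := by
        rw [Finset.mem_image]
        constructor
        · rintro ⟨q, hq, hqp⟩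
          rw [← hinj q (hSD hq) p hp hqp]; exact hq
        · intro hp; exact ⟨p, hp, rfl⟩
      rw [this, hS p hp]
      constructor
      · intro h g hg
        obtain ⟨q, hq, rfl⟩ := Finset.mem_image.1 hg
        rw [hcr p hp q (hSD hq)]; exact h q hq
      · intro h q hq
        rw [← hcr p hp q (hSD hq)]; exact h _ (Finset.mem_image_of_mem _ hq)

lemma image_injOn {m n : ℕ} : Set.InjOn (fun S : Finset (ℕ × ℕ) => S.image (phi (m * n + 2)))
        (Mx crs (Dg m (Finset.range (m * n + 2))) : Set (Finset (ℕ × ℕ))) := by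
  intro S hS T hT h
  rw [Finset.mem_coe, mem_Mx] at hS hT
  have hsub : ∀ S T : Finset (ℕ × ℕ), S ⊆ Dg m (Finset.range (m * n + 2)) →
      T ⊆ Dg m (Finset.range (m * n + 2)) →
      S.image (phi (m * n + 2)) = T.image (phi (m * n + 2)) → S ⊆ T := by
    intro S T hS hT h p hp
    have := Finset.mem_image_of_mem (phi (m * n + 2)) hp
    rw [h, Finset.mem_image] at this
    obtain ⟨q, hq, hqp⟩ := this
    have h1 := hS hp
    have h2 := hT hq
    obtain ⟨a, b⟩ := p
    obtain ⟨c, d⟩ := q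
    rw [mem_Dg_range] at h1 h2
    rw [← phi_inj h2.1 h2.2.1 h1.1 h1.2.1 hqp]; exact hq
  exact Finset.Subset.antisymm (hsub S T hS.1 hT.1 h) (hsub T S hT.1 hS.1 h.symm)

theorem angulations_count_fuss_catalan (m n : ℕ) (hm : 1 ≤ m) (hn : 2 ≤ n) :
    (m * n + 1) *
        {Δ : Finset (Finset (ZMod (m * n + 2))) | IsAngulation m n Δ}.ncard =
      Nat.choose ((m + 1) * n) n := by
  rw [ang_eq_image hm, Set.InjOn.ncard_image image_injOn, Set.ncard_coe_finset,
    (main_count m hm n (by omega) (Finset.range (m * n + 2)) (by simp)).1, fc_closed]
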